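/- arXiv:math/0607572 — 2 statements merged into one kernel-verified Lean document; each statement's English description precedes it below -/
import Mathlib

section
/- Let T: V × V → V be a symmetric bilinear map with ℓ(T(X,Y)) = 0 for all X,Y. Define the trilinear form A*(X,Y,Z) := (1/(2L))[h(X,Y)ν(Z) + h(Y,Z)ν(X) + h(X,Z)ν(Y)] − ω(T(X,Y))·ℓ*(Z), and the symmetric bilinear vector-valued map A(X,Y) := (1/(2L*))[h(X,Y)·m + ν(X)·φ(Y) + ν(Y)·φ(X)] − (1/(2L*²))[2L*·ω(T(X,Y)) + 2ν(X)ν(Y) + ν(m)·h(X,Y)]·η. Then g*(A(X,Y), Z) = A*(X,Y,Z) for all X, Y, Z ∈ V. (Proposition 4 of the paper: the explicit expression of the tensor field A obtained from equation (10) by raising an index with g*.) -/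
open scoped RealInnerProductSpace

noncomputable section

variable {V : Type*} [NormedAddCommGroup V] [InnerProductSpace ℝ V]

/-- `ℓ(X) = g(X,η)/L` with `L = ‖η‖`. -/
def ell (η X : V) : ℝ := ⟪X, η⟫ / ‖η‖

/-- `ω(X) = g(b,X)`. -/
def omega (b X : V) : ℝ := ⟪b, X⟫

/-- `ℓ*(X) = ℓ(X) + ω(X)`. -/
def ellStar (η b X : V) : ℝ := ell η X + omega b X

/-- angular metric `h(X,Y) = g(X,Y) - ℓ(X)ℓ(Y)`. -/
def hAng (η X Y : V) : ℝ := ⟪X, Y⟫ - ell η X * ell η Y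

/-- `g*(X,Y) = τ·h(X,Y) + ℓ*(X)ℓ*(Y)` with `τ = L*/L`. -/
def gStar (η b X Y : V) : ℝ :=
  ((‖η‖ + ⟪b, η⟫) / ‖η‖) * hAng η X Y + ellStar η b X * ellStar η b Y

/-- `m = b - (α/L²)η` with `α = g(b,η)`. -/
def mVec (η b : V) : V := b - ((⟪b, η⟫ / ‖η‖ ^ 2) • η)

/-- `ν(X) = g(m,X)`. -/
def nu (η b X : V) : ℝ := ⟪mVec η b, X⟫

/-- `φ(X) = X - ℓ(X)η/L`. -/
def phi (η X : V) : V := X - (ell η X / ‖η‖) • η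

/-- The trilinear form of equation (10):
`A*(X,Y,Z) = (1/(2L))[h(X,Y)ν(Z) + h(Y,Z)ν(X) + h(X,Z)ν(Y)] - ω(T(X,Y))·ℓ*(Z)`. -/
def AStar (η b : V) (T : V →ₗ[ℝ] V →ₗ[ℝ] V) (X Y Z : V) : ℝ :=
  (1 / (2 * ‖η‖)) * (hAng η X Y * nu η b Z + hAng η Y Z * nu η b X + hAng η X Z * nu η b Y)
    - omega b (T X Y) * ellStar η b Z

/-- The vector-valued map `A` of Proposition 4:
`A(X,Y) = (1/(2L*))[h(X,Y)·m + ν(X)·φ(Y) + ν(Y)·φ(X)]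
  - (1/(2L*²))[2L*·ω(T(X,Y)) + 2ν(X)ν(Y) + ν(m)·h(X,Y)]·η`. -/
def Amap (η b : V) (T : V →ₗ[ℝ] V →ₗ[ℝ] V) (X Y : V) : V :=
  (1 / (2 * (‖η‖ + ⟪b, η⟫))) •
      (hAng η X Y • mVec η b + nu η b X • phi η Y + nu η b Y • phi η X)
    - ((1 / (2 * (‖η‖ + ⟪b, η⟫) ^ 2)) *
        (2 * (‖η‖ + ⟪b, η⟫) * omega b (T X Y) + 2 * nu η b X * nu η b Y
          + nu η b (mVec η b) * hAng η X Y)) • η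

/-- Proposition 4: `g*(A(X,Y),Z) = A*(X,Y,Z)` for all `X,Y,Z`, where `T` is a
symmetric bilinear map with `ℓ(T(X,Y)) = 0`. -/
theorem prop4 (η b : V) (hη : η ≠ 0) (hLstar : 0 < ‖η‖ + ⟪b, η⟫)
    (T : V →ₗ[ℝ] V →ₗ[ℝ] V) (hTsymm : ∀ X Y : V, T X Y = T Y X)
    (hTell : ∀ X Y : V, ell η (T X Y) = 0) :
    ∀ X Y Z : V, gStar η b (Amap η b T X Y) Z = AStar η b T X Y Z := by
  intro X Y Z
  have hL : ‖η‖ ≠ 0 := norm_ne_zero_iff.mpr hη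
  have hS : ‖η‖ + ⟪b, η⟫ ≠ 0 := hLstar.ne'
  have hηη : ⟪η, η⟫ = ‖η‖ ^ 2 := real_inner_self_eq_norm_sq η
  have hadd : ∀ U W Z : V, hAng η (U + W) Z = hAng η U Z + hAng η W Z := by
    intro U W Z; simp only [hAng, ell, inner_add_left]; ring
  have hsub : ∀ U W Z : V, hAng η (U - W) Z = hAng η U Z - hAng η W Z := by
    intro U W Z; simp only [hAng, ell, inner_sub_left]; ring
  have hsmul : ∀ (a : ℝ) (U Z : V), hAng η (a • U) Z = a * hAng η U Z := by
    intro a U Z; simp only [hAng, ell, real_inner_smul_left]; ring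
  have hη0 : ∀ Z : V, hAng η η Z = 0 := by
    intro Z; simp only [hAng, ell, hηη, real_inner_comm η Z]; field_simp; ring
  have hm : ∀ Z : V, hAng η (mVec η b) Z = nu η b Z := by
    intro Z
    simp only [hAng, ell, nu, mVec, inner_sub_left, real_inner_smul_left, hηη,
      real_inner_comm η Z]
    field_simp; ring
  have hphi : ∀ Y Z : V, hAng η (phi η Y) Z = hAng η Y Z := by
    intro Y Z; rw [phi, hsub, hsmul, hη0]; ring
  have ladd : ∀ U W : V, ellStar η b (U + W) = ellStar η b U + ellStar η b W := by
    intro U W; simp only [ellStar, omega, ell, inner_add_left, inner_add_right]; ring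
  have lsub : ∀ U W : V, ellStar η b (U - W) = ellStar η b U - ellStar η b W := by
    intro U W; simp only [ellStar, omega, ell, inner_sub_left, inner_sub_right]; ring
  have lsmul : ∀ (a : ℝ) (U : V), ellStar η b (a • U) = a * ellStar η b U := by
    intro a U; simp only [ellStar, omega, ell, real_inner_smul_left, real_inner_smul_right]; ring
  have lη : ellStar η b η = ‖η‖ + ⟪b, η⟫ := by
    simp only [ellStar, omega, ell, hηη]; field_simp
  have lm : ellStar η b (mVec η b) = nu η b (mVec η b) := by
    simp only [ellStar, omega, ell, nu, mVec, inner_sub_left, inner_sub_right,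
      real_inner_smul_left, real_inner_smul_right, hηη, real_inner_comm b η]
    field_simp; ring
  have lphi : ∀ Y : V, ellStar η b (phi η Y) = nu η b Y := by
    intro Y
    simp only [ellStar, omega, ell, nu, mVec, phi, inner_sub_left, inner_sub_right,
      real_inner_smul_left, real_inner_smul_right, hηη, real_inner_comm Y η]
    field_simp; ring
  have key : ellStar η b (Amap η b T X Y) = - omega b (T X Y) := by
    simp only [Amap, lsub, ladd, lsmul, lη, lm, lphi]
    field_simp; ring
  rw [gStar, key]
  simp only [Amap, AStar, hsub, hadd, hsmul, hη0, hm, hphi]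
  field_simp; ring

end
end

section
/- Let T: V × V → V be a symmetric bilinear map with ℓ(T(X,Y)) = 0 for all X,Y, let A be defined by A(X,Y) := (1/(2L*))[h(X,Y)·m + ν(X)·φ(Y) + ν(Y)·φ(X)] − (1/(2L*²))[2L*·ω(T(X,Y)) + 2ν(X)ν(Y) + ν(m)·h(X,Y)]·η, and set T*(X,Y) := T(X,Y) + A(X,Y). Then for all X,Y,Z ∈ V: g*(T*(X,Y), Z) = τ·g(T(X,Y), Z) + (1/(2L))[h(X,Y)ν(Z) + h(Y,Z)ν(X) + h(X,Z)ν(Y)]. (Corollary 3 of the paper, stated pointwise: the relation between the Cartan torsion tensors of a generalized Randers manifold and of its associated Finsler manifold.) -/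
open scoped RealInnerProductSpace

noncomputable section

variable {V : Type*} [NormedAddCommGroup V] [InnerProductSpace ℝ V]

theorem ell_add' (η X Y : V) : ell η (X + Y) = ell η X + ell η Y := by
  simp only [ell, inner_add_left]; ring

theorem ell_sub' (η X Y : V) : ell η (X - Y) = ell η X - ell η Y := by
  simp only [ell, inner_sub_left]; ring

theorem ell_smul' (η : V) (c : ℝ) (X : V) : ell η (c • X) = c * ell η X := by
  simp only [ell, real_inner_smul_left]; ring

theorem ell_eta (η : V) (hη : η ≠ 0) : ell η η = ‖η‖ := by
  have h : ‖η‖ ≠ 0 := norm_ne_zero_iff.mpr hη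
  simp only [ell, real_inner_self_eq_norm_sq]; field_simp

theorem ell_phi (η : V) (hη : η ≠ 0) (X : V) : ell η (phi η X) = 0 := by
  have h : ‖η‖ ≠ 0 := norm_ne_zero_iff.mpr hη
  rw [phi, ell_sub', ell_smul', ell_eta η hη]; field_simp; ring

theorem ell_mVec (η b : V) (hη : η ≠ 0) : ell η (mVec η b) = 0 := by
  have h : ‖η‖ ≠ 0 := norm_ne_zero_iff.mpr hη
  rw [mVec, ell_sub', ell_smul', ell_eta η hη, ell]; field_simp; ring

theorem inner_eta (η : V) (hη : η ≠ 0) (Z : V) : ⟪η, Z⟫ = ‖η‖ * ell η Z := by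
  have h : ‖η‖ ≠ 0 := norm_ne_zero_iff.mpr hη
  rw [ell, real_inner_comm]; field_simp

theorem inner_phi (η : V) (hη : η ≠ 0) (X Z : V) : ⟪phi η X, Z⟫ = hAng η X Z := by
  have h : ‖η‖ ≠ 0 := norm_ne_zero_iff.mpr hη
  rw [phi, inner_sub_left, real_inner_smul_left, inner_eta η hη, hAng]; field_simp

theorem omega_phi (η b : V) (X : V) : omega b (phi η X) = nu η b X := by
  rw [phi, omega, nu, mVec, inner_sub_left, inner_sub_right, real_inner_smul_left,
    real_inner_smul_right, ell, real_inner_comm X η]; ring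

theorem omega_mVec (η b : V) (hη : η ≠ 0) : omega b (mVec η b) = nu η b (mVec η b) := by
  have h := ell_mVec η b hη
  rw [nu]
  conv_rhs => rw [show ⟪mVec η b, mVec η b⟫ = ⟪b - ((⟪b, η⟫ / ‖η‖ ^ 2) • η), mVec η b⟫ from rfl]
  rw [inner_sub_left, real_inner_smul_left, inner_eta η hη, h, omega]; ring

/-- Corollary 3: with `T*(X,Y) = T(X,Y) + A(X,Y)`, for all `X,Y,Z`:
`g*(T*(X,Y),Z) = τ·g(T(X,Y),Z)
  + (1/(2L))[h(X,Y)ν(Z) + h(Y,Z)ν(X) + h(X,Z)ν(Y)]`. -/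
theorem cor3 (η b : V) (hη : η ≠ 0) (hLstar : 0 < ‖η‖ + ⟪b, η⟫)
    (T : V →ₗ[ℝ] V →ₗ[ℝ] V) (hTsymm : ∀ X Y : V, T X Y = T Y X)
    (hTell : ∀ X Y : V, ell η (T X Y) = 0) :
    ∀ X Y Z : V,
      gStar η b (T X Y + Amap η b T X Y) Z
        = ((‖η‖ + ⟪b, η⟫) / ‖η‖) * ⟪T X Y, Z⟫
          + (1 / (2 * ‖η‖)) *
              (hAng η X Y * nu η b Z + hAng η Y Z * nu η b X + hAng η X Z * nu η b Y) := by
  intro X Y Z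
  have hL : ‖η‖ ≠ 0 := norm_ne_zero_iff.mpr hη
  have hS : ‖η‖ + ⟪b, η⟫ ≠ 0 := hLstar.ne'
  have e1 : ell η (T X Y + Amap η b T X Y) = - ((1 / (2 * (‖η‖ + ⟪b, η⟫) ^ 2)) *
        (2 * (‖η‖ + ⟪b, η⟫) * omega b (T X Y) + 2 * nu η b X * nu η b Y
          + nu η b (mVec η b) * hAng η X Y)) * ‖η‖ := by
    simp only [Amap, ell_add', ell_sub', ell_smul', ell_phi η hη, ell_mVec η b hη, hTell,
      ell_eta η hη]
    ring
  have e2 : ⟪T X Y + Amap η b T X Y, Z⟫ = ⟪T X Y, Z⟫ + (1 / (2 * (‖η‖ + ⟪b, η⟫))) *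
      (hAng η X Y * nu η b Z + nu η b X * hAng η Y Z + nu η b Y * hAng η X Z)
      + ell η (T X Y + Amap η b T X Y) * ell η Z := by
    rw [e1]
    simp only [Amap, inner_add_left, inner_sub_left, real_inner_smul_left, inner_phi η hη,
      inner_eta η hη]
    simp only [nu]
    ring
  have e3 : ellStar η b (T X Y + Amap η b T X Y) = 0 := by
    rw [ellStar, e1]
    have e4 : omega b (T X Y + Amap η b T X Y) = omega b (T X Y)
        + (1 / (2 * (‖η‖ + ⟪b, η⟫))) * (hAng η X Y * omega b (mVec η b)
          + nu η b X * omega b (phi η Y) + nu η b Y * omega b (phi η X))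
        - ((1 / (2 * (‖η‖ + ⟪b, η⟫) ^ 2)) *
        (2 * (‖η‖ + ⟪b, η⟫) * omega b (T X Y) + 2 * nu η b X * nu η b Y
          + nu η b (mVec η b) * hAng η X Y)) * ⟪b, η⟫ := by
      rw [Amap]
      simp only [omega, inner_add_right, inner_sub_right, real_inner_smul_right]
      ring
    rw [e4, omega_phi, omega_phi, omega_mVec η b hη]
    generalize ⟪b, η⟫ = a at *
    field_simp
    ring
  rw [gStar, e3, hAng, e2]
  generalize ⟪b, η⟫ = a at *
  field_simp
  ring

end
end
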